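/- arXiv:2005.03269 — 2 statements merged into one kernel-verified Lean document; each statement's English description precedes it below -/
import Mathlib

section
/- (i) If x ∈ [0, ρ], then for any r with max{x, ρ−x} ≤ r ≤ 1−x one has μ(B(x,r))/(2r)^s ≥ ρ^s/(2^s (R−x)^s), with equality when r = R−x. (ii) If x ∈ [1−ρ, 1], then for any r with max{1−x, ρ−(1−x)} ≤ r ≤ x one has μ(B(x,r))/(2r)^s ≥ ρ^s/(2^s (R−(1−x))^s), with equality when r = R−(1−x). -/
open MeasureTheory Filter Set Topology ENNReal

namespace HomogeneousCantorDensity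

noncomputable def R (N : ℕ) (ρ : ℝ) : ℝ := (1 - ρ) / ((N : ℝ) - 1)

noncomputable def f (N : ℕ) (ρ : ℝ) (i : ℕ) (x : ℝ) : ℝ := ρ * x + (i : ℝ) * R N ρ

noncomputable def piMap (N : ℕ) (ρ : ℝ) (d : ℕ → ℕ) : ℝ :=
  R N ρ * ∑' i : ℕ, (d i : ℝ) * ρ ^ i

def cantorE (N : ℕ) (ρ : ℝ) : Set ℝ :=
  {x | ∃ d : ℕ → ℕ, (∀ i, d i < N) ∧ x = piMap N ρ d}

/-- `μ = ∑_{i=0}^{N-1} (1/N) μ ∘ f_i⁻¹`. -/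
def IsSelfSimilar (N : ℕ) (ρ : ℝ) (μ : Measure ℝ) : Prop :=
  μ = ∑ i ∈ Finset.range N, (N : ℝ≥0∞)⁻¹ • μ.map (f N ρ i)

/-- `T^n x` for `x = piMap N ρ d`. -/
noncomputable def Tn (N : ℕ) (ρ : ℝ) (d : ℕ → ℕ) (n : ℕ) : ℝ :=
  piMap N ρ (fun i => d (n + i))

/-- pointwise lower `s`-density of `μ` at `x`. -/
noncomputable def lowerDensity (μ : Measure ℝ) (s x : ℝ) : ℝ :=
  liminf (fun r : ℝ => (μ (Ioo (x - r) (x + r))).toReal / (2 * r) ^ s) (𝓝[>] 0)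

/-- pointwise upper `s`-density of `μ` at `x`. -/
noncomputable def upperDensity (μ : Measure ℝ) (s x : ℝ) : ℝ :=
  limsup (fun r : ℝ => (μ (Ioo (x - r) (x + r))).toReal / (2 * r) ^ s) (𝓝[>] 0)

theorem cdf_eq (N : ℕ) (hN : 2 ≤ N) (ρ : ℝ) (hρ0 : 0 < ρ)
    (μ : Measure ℝ) (hprob : IsProbabilityMeasure μ) (hss : IsSelfSimilar N ρ μ)
    (A : Set ℝ) (hA : MeasurableSet A) :
    (N : ℝ) * μ.real A = ∑ i ∈ Finset.range N, μ.real (f N ρ i ⁻¹' A) := by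
  have hN0 : (N : ℝ) ≠ 0 := by positivity
  have hm : ∀ i, Measurable (f N ρ i) := by intro i; unfold f; fun_prop
  have h1 : μ A = ∑ i ∈ Finset.range N, (N : ℝ≥0∞)⁻¹ * μ (f N ρ i ⁻¹' A) := by
    conv_lhs => rw [hss]
    rw [Measure.finsetSum_apply]
    refine Finset.sum_congr rfl fun i _ => ?_
    rw [Measure.smul_apply, Measure.map_apply (hm i) hA, smul_eq_mul]
  have h2 : μ.real A = ∑ i ∈ Finset.range N, (N : ℝ)⁻¹ * μ.real (f N ρ i ⁻¹' A) := by
    unfold Measure.real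
    rw [h1, ENNReal.toReal_sum]
    · refine Finset.sum_congr rfl fun i _ => ?_
      rw [ENNReal.toReal_mul]; simp
    · intro i _
      refine ENNReal.mul_ne_top ?_ (measure_ne_top _ _)
      simp; omega
  rw [h2, ← Finset.mul_sum, ← mul_assoc, mul_inv_cancel₀ hN0, one_mul]

theorem preimage_Iio (N : ℕ) (ρ : ℝ) (hρ0 : 0 < ρ) (i : ℕ) (t : ℝ) :
    f N ρ i ⁻¹' (Iio t) = Iio ((t - i * R N ρ) / ρ) := by
  ext y
  simp only [f, mem_preimage, mem_Iio]
  rw [lt_div_iff₀ hρ0]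
  constructor <;> intro h <;> linarith

theorem R_bounds (N : ℕ) (hN : 2 ≤ N) (ρ : ℝ) (hρ0 : 0 < ρ)
    (hρ1 : ρ ≤ 1 / (N : ℝ) ^ 2) :
    ρ * N + ρ ≤ R N ρ ∧ (N - 1 : ℝ) * R N ρ = 1 - ρ ∧ ρ ≤ 1 / 4 := by
  have hN' : (2 : ℝ) ≤ N := by exact_mod_cast hN
  have h := hρ1
  rw [le_div_iff₀ (by positivity)] at h
  refine ⟨?_, ?_, ?_⟩
  · unfold R
    rw [le_div_iff₀ (by linarith)]
    nlinarith
  · unfold R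
    rw [mul_div_cancel₀]
    linarith
  · nlinarith [mul_le_mul_of_nonneg_left (mul_le_mul hN' hN' (by norm_num) (by linarith)) hρ0.le]

theorem neg_null (N : ℕ) (hN : 2 ≤ N) (ρ : ℝ) (hρ0 : 0 < ρ)
    (hρ1 : ρ ≤ 1 / (N : ℝ) ^ 2)
    (μ : Measure ℝ) (hprob : IsProbabilityMeasure μ) (hss : IsSelfSimilar N ρ μ) :
    ∀ c : ℝ, 0 < c → μ.real (Iio (-c)) = 0 := by
  obtain ⟨hR1, hR2, hR3⟩ := R_bounds N hN ρ hρ0 hρ1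
  have hN' : (2 : ℝ) ≤ N := by exact_mod_cast hN
  have hR0 : 0 < R N ρ := by nlinarith
  have step : ∀ c : ℝ, μ.real (Iio (-c)) ≤ μ.real (Iio (-(c / ρ))) := by
    intro c
    have h := cdf_eq N hN ρ hρ0 μ hprob hss (Iio (-c)) measurableSet_Iio
    have h2 : ∑ i ∈ Finset.range N, μ.real (f N ρ i ⁻¹' (Iio (-c)))
        ≤ ∑ i ∈ Finset.range N, μ.real (Iio (-(c / ρ))) := by
      refine Finset.sum_le_sum fun i _ => ?_
      rw [preimage_Iio N ρ hρ0]
      refine measureReal_mono (Iio_subset_Iio ?_)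
      rw [← neg_div]
      gcongr
      have : 0 ≤ (i : ℝ) * R N ρ := by positivity
      linarith
    rw [← h, Finset.sum_const, Finset.card_range, nsmul_eq_mul] at h2
    exact le_of_mul_le_mul_left h2 (by linarith)
  have step2 : ∀ (n : ℕ) (c : ℝ), μ.real (Iio (-c)) ≤ μ.real (Iio (-(c * (1 / ρ) ^ n))) := by
    intro n
    induction n with
    | zero => intro c; simp
    | succ n ih =>
      intro c
      refine (ih c).trans ((step _).trans (le_of_eq ?_))
      congr 3
      rw [pow_succ]; ring
  intro c hc
  have hlim : Tendsto (fun n : ℕ => -(c * (1 / ρ) ^ n)) atTop atBot := by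
    refine tendsto_neg_atTop_atBot.comp ?_
    refine Tendsto.const_mul_atTop hc ?_
    exact tendsto_pow_atTop_atTop_of_one_lt (by rw [lt_div_iff₀ hρ0]; linarith)
  have hF : Tendsto (fun t : ℝ => μ.real (Iic t)) atBot (𝓝 0) := by
    have := ProbabilityTheory.tendsto_cdf_atBot μ
    refine this.congr fun t => ?_
    rw [ProbabilityTheory.cdf_eq_real]
  have hle : μ.real (Iio (-c)) ≤ 0 := by
    refine ge_of_tendsto (hF.comp hlim) (Eventually.of_forall fun n => ?_)
    exact (step2 n c).trans (measureReal_mono Iio_subset_Iic_self)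
  exact le_antisymm hle measureReal_nonneg

theorem Iic_null (N : ℕ) (hN : 2 ≤ N) (ρ : ℝ) (hρ0 : 0 < ρ)
    (hρ1 : ρ ≤ 1 / (N : ℝ) ^ 2)
    (μ : Measure ℝ) (hprob : IsProbabilityMeasure μ) (hss : IsSelfSimilar N ρ μ) :
    μ (Iic 0) = 0 := by
  obtain ⟨hR1, hR2, hR3⟩ := R_bounds N hN ρ hρ0 hρ1
  have hN' : (2 : ℝ) ≤ N := by exact_mod_cast hN
  have hR0 : 0 < R N ρ := by nlinarith
  have hneg := neg_null N hN ρ hρ0 hρ1 μ hprob hss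
  have h := cdf_eq N hN ρ hρ0 μ hprob hss (Iic 0) measurableSet_Iic
  obtain ⟨M, rfl⟩ : ∃ M, N = M + 1 := ⟨N - 1, by omega⟩
  rw [Finset.sum_range_succ', Finset.sum_eq_zero] at h
  · have h0 : f (M + 1) ρ 0 ⁻¹' (Iic 0) = Iic 0 := by
      ext y
      simp only [f, mem_preimage, mem_Iic]
      constructor <;> intro h <;> (push_cast at *; nlinarith)
    rw [h0] at h
    have : μ.real (Iic 0) = 0 := by nlinarith
    simpa [Measure.real, ENNReal.toReal_eq_zero_iff] using this
  · intro i _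
    refine le_antisymm ?_ measureReal_nonneg
    refine le_trans (measureReal_mono ?_) (hneg (R (M + 1) ρ / (2 * ρ)) (by positivity)).le
    intro y hy
    simp only [f, mem_preimage, mem_Iic, mem_Iio] at hy ⊢
    push_cast at hy
    have hi : 0 ≤ (i : ℝ) * R (M + 1) ρ := by positivity
    rw [← neg_div, lt_div_iff₀ (by positivity)]
    linarith

theorem reflect (N : ℕ) (hN : 2 ≤ N) (ρ : ℝ) (hρ0 : 0 < ρ)
    (hρ1 : ρ ≤ 1 / (N : ℝ) ^ 2)
    (μ : Measure ℝ) (hss : IsSelfSimilar N ρ μ) :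
    IsSelfSimilar N ρ (μ.map (fun x => 1 - x)) := by
  obtain ⟨hR1, hR2, hR3⟩ := R_bounds N hN ρ hρ0 hρ1
  have hm : ∀ i, Measurable (f N ρ i) := by intro i; unfold f; fun_prop
  have hg : Measurable (fun x : ℝ => 1 - x) := by fun_prop
  unfold IsSelfSimilar
  have e : ∀ i ∈ Finset.range N, (N : ℝ≥0∞)⁻¹ • (μ.map (fun x => 1 - x)).map (f N ρ i)
      = (N : ℝ≥0∞)⁻¹ • (μ.map (f N ρ (N - 1 - i))).map (fun x => 1 - x) := by
    intro i hi
    rw [Finset.mem_range] at hi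
    rw [Measure.map_map (hm _) hg, Measure.map_map hg (hm _)]
    congr 2
    funext y
    simp only [f, Function.comp]
    have : ((N - 1 - i : ℕ) : ℝ) = N - 1 - i := by
      rw [Nat.cast_sub (by omega), Nat.cast_sub (by omega)]; simp
    rw [this]
    linarith
  rw [Finset.sum_congr rfl e, Finset.sum_range_reflect
    (fun j => (N : ℝ≥0∞)⁻¹ • (μ.map (f N ρ j)).map (fun x => 1 - x))]
  conv_lhs => rw [hss]
  ext A hA
  rw [Measure.map_apply hg hA, Measure.finsetSum_apply, Measure.finsetSum_apply]
  refine Finset.sum_congr rfl fun i _ => ?_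
  rw [Measure.smul_apply, Measure.smul_apply, Measure.map_apply hg hA]

theorem core (N : ℕ) (hN : 2 ≤ N) (ρ Q : ℝ) (hρ0 : 0 < ρ)
    (hR1 : ρ * N + ρ ≤ Q) (hR2 : (N - 1 : ℝ) * Q = 1 - ρ) (hR3 : ρ ≤ 1 / 4)
    (F : ℝ → ℝ) (hF0 : ∀ t, 0 ≤ F t) (hF1 : ∀ t, 1 ≤ t → F t = 1)
    (hmono : Monotone F)
    (hF : ∀ t, (N : ℝ) * F t = ∑ i ∈ Finset.range N, F ((t - i * Q) / ρ))
    (t : ℝ) (ht : Q ≤ t) (ht1 : t ≤ 1) :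
    t - ρ ≤ (N * F t) ^ 2 * (Q - ρ) := by
  have hN' : (2 : ℝ) ≤ N := by exact_mod_cast hN
  have hQ0 : 0 < Q := by nlinarith
  have hpow : ∀ n : ℕ, 1 ≤ (N : ℝ) ^ n * F (ρ ^ n) := by
    intro n
    induction n with
    | zero => simp [hF1 1 le_rfl]
    | succ n ih =>
      have h : F (ρ ^ n) ≤ N * F (ρ ^ (n + 1)) := by
        rw [hF]
        have := Finset.single_le_sum (f := fun i : ℕ => F ((ρ ^ (n + 1) - i * Q) / ρ))
          (fun i _ => hF0 _) (Finset.mem_range.2 (show 0 < N by omega))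
        refine le_trans (le_of_eq ?_) this
        congr 1
        rw [pow_succ]; field_simp; simp
      calc (1 : ℝ) ≤ N ^ n * F (ρ ^ n) := ih
        _ ≤ N ^ n * (N * F (ρ ^ (n + 1))) := by gcongr
        _ = _ := by ring
  have hlin : ∀ v : ℝ, 0 ≤ v → v ≤ 1 → v ≤ N * F v := by
    intro v hv hv1
    rcases hv.eq_or_lt with rfl | hv
    · have := hF0 0; positivity
    obtain ⟨n, h1, h2⟩ := exists_nat_pow_near_of_lt_one hv hv1 hρ0 (by linarith)
    have h3 := hpow (n + 1)
    have h4 : F (ρ ^ (n + 1)) ≤ F v := hmono h1.le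
    have h5 : (N : ℝ) ^ n * ρ ^ n ≤ 1 := by
      rw [← mul_pow]
      refine pow_le_one₀ (by positivity) ?_
      nlinarith
    have hp : (0 : ℝ) < N ^ n := by positivity
    refine le_of_mul_le_mul_left ?_ hp
    calc (N : ℝ) ^ n * v ≤ N ^ n * ρ ^ n := by gcongr
      _ ≤ 1 := h5
      _ ≤ _ := h3
      _ ≤ N ^ (n + 1) * F v := by gcongr
      _ = _ := by ring
  obtain ⟨k, hk⟩ : ∃ k, k = ⌊t / Q⌋₊ := ⟨_, rfl⟩
  have hkl : (k : ℝ) * Q ≤ t := by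
    rw [← le_div_iff₀ hQ0, hk]
    exact Nat.floor_le (by apply div_nonneg <;> linarith)
  have hku : t < (k + 1) * Q := by
    rw [← div_lt_iff₀ hQ0, hk]
    exact Nat.lt_floor_add_one _
  have hk1 : 1 ≤ k := by
    rw [hk]; apply Nat.le_floor
    rw [le_div_iff₀ hQ0]; simpa using ht
  have hkN : k < N := by
    have : (k : ℝ) < N := by nlinarith
    exact_mod_cast this
  have hk1' : (1 : ℝ) ≤ k := by exact_mod_cast hk1
  have hsum : (k : ℝ) + F ((t - k * Q) / ρ) ≤ N * F t := by
    rw [hF]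
    calc (k : ℝ) + F ((t - k * Q) / ρ) = ∑ i ∈ Finset.range (k + 1), F ((t - i * Q) / ρ) := by
          rw [Finset.sum_range_succ, Finset.sum_congr rfl (g := fun _ => (1 : ℝ))]
          · simp
          · intro i hi
            rw [Finset.mem_range] at hi
            have : (i : ℝ) + 1 ≤ k := by exact_mod_cast hi
            apply hF1
            rw [le_div_iff₀ hρ0]
            nlinarith
      _ ≤ _ := by
          refine Finset.sum_le_sum_of_subset_of_nonneg ?_ fun i _ _ => hF0 _
          intro i hi
          rw [Finset.mem_range] at *
          omega
  obtain ⟨D, hD⟩ : ∃ D, D = Q - ρ := ⟨_, rfl⟩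
  have hDN : N * ρ ≤ D := by linarith
  have hD0 : 0 < D := by nlinarith
  have hDρ : ρ ≤ D := by nlinarith
  rw [← hD]
  have hQ : Q = D + ρ := by linarith
  rw [hQ] at hku hkl
  have hw0 := hF0 ((t - k * Q) / ρ)
  have hsq : (k + F ((t - k * Q) / ρ)) ^ 2 * D ≤ (N * F t) ^ 2 * D := by
    gcongr
  refine le_trans ?_ hsq
  rcases le_total ρ (t - k * Q) with hg | hg
  · rw [hF1 ((t - k * Q) / ρ) (by rw [le_div_iff₀ hρ0]; linarith)]
    nlinarith [mul_nonneg (show (0 : ℝ) ≤ k by linarith) (sub_nonneg.2 hDρ),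
      mul_nonneg (mul_nonneg (show (0 : ℝ) ≤ k by linarith) (show (0 : ℝ) ≤ k by linarith)) hD0.le]
  · have h := hlin ((t - k * Q) / ρ) (by apply div_nonneg <;> nlinarith)
      (by rw [div_le_iff₀ hρ0]; linarith)
    obtain ⟨v, hv⟩ : ∃ v, v = (t - k * Q) / ρ := ⟨_, rfl⟩
    rw [← hv] at h hw0 ⊢
    generalize F v = w at *
    have hvt : t = k * (D + ρ) + ρ * v := by rw [hv, ← hQ]; field_simp; ring
    rw [hvt]
    have a1 : ρ * v ≤ w * D := by nlinarith
    have a2 : (k - 1) * ρ ≤ (k - 1) * D := mul_le_mul_of_nonneg_left hDρ (by linarith)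
    have a3 : (k - 1) * D ≤ k * ((k - 1) * D) :=
      le_mul_of_one_le_left (mul_nonneg (by linarith) hD0.le) hk1'
    have a4 : w * D ≤ k * (w * D) := le_mul_of_one_le_left (by positivity) hk1'
    have a5 : 0 ≤ w ^ 2 * D := by positivity
    have a6 : 0 ≤ w * D := by positivity
    nlinarith

theorem left_part (N : ℕ) (hN : 2 ≤ N) (ρ : ℝ) (hρ0 : 0 < ρ)
    (hρ1 : ρ ≤ 1 / (N : ℝ) ^ 2) (s : ℝ) (hs : s = -Real.log N / Real.log ρ)
    (μ : Measure ℝ) (hprob : IsProbabilityMeasure μ) (hss : IsSelfSimilar N ρ μ) :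
    ∀ x ∈ Icc (0 : ℝ) ρ,
      (∀ r : ℝ, max x (ρ - x) ≤ r → r ≤ 1 - x →
        ρ ^ s / ((2 : ℝ) ^ s * (R N ρ - x) ^ s) ≤
          (μ (Ioo (x - r) (x + r))).toReal / (2 * r) ^ s) ∧
      (μ (Ioo (x - (R N ρ - x)) (x + (R N ρ - x)))).toReal / (2 * (R N ρ - x)) ^ s =
        ρ ^ s / ((2 : ℝ) ^ s * (R N ρ - x) ^ s) := by
  obtain ⟨hR1, hR2, hR3⟩ := R_bounds N hN ρ hρ0 hρ1
  have hN' : (2 : ℝ) ≤ N := by exact_mod_cast hN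
  have hN0 : (0 : ℝ) < N := by linarith
  have hlogN : 0 < Real.log N := Real.log_pos (by linarith)
  have hlogρ : Real.log ρ < 0 := Real.log_neg hρ0 (by linarith)
  have hρs : ρ ^ s = 1 / N := by
    rw [Real.rpow_def_of_pos hρ0, hs, mul_div_cancel₀ _ hlogρ.ne, Real.exp_neg,
      Real.exp_log hN0, one_div]
  have hs0 : 0 < s := by rw [hs]; exact div_pos_of_neg_of_neg (by linarith) hlogρ
  have hs1 : s ≤ 1 / 2 := by
    have h : Real.log ρ ≤ Real.log (1 / (N : ℝ) ^ 2) := Real.log_le_log hρ0 hρ1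
    rw [one_div, Real.log_inv, Real.log_pow] at h
    rw [hs, div_le_iff_of_neg hlogρ]
    push_cast at h
    linarith
  have hnull := Iic_null N hN ρ hρ0 hρ1 μ hprob hss
  have hg : Measurable (fun x : ℝ => 1 - x) := by fun_prop
  have hnull2 : μ (Ici 1) = 0 := by
    have h := Iic_null N hN ρ hρ0 hρ1 (μ.map (fun x => 1 - x))
      (Measure.isProbabilityMeasure_map hg.aemeasurable) (reflect N hN ρ hρ0 hρ1 μ hss)
    rw [Measure.map_apply hg measurableSet_Iic] at h
    rw [← h]
    congr 1
    ext y
    simp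
  have hF1 : ∀ t : ℝ, 1 ≤ t → μ.real (Iio t) = 1 := by
    intro t ht
    have h : μ (Iio t)ᶜ = 0 := measure_mono_null (by intro y; simp; intro; linarith) hnull2
    rw [prob_compl_eq_zero_iff measurableSet_Iio] at h
    simp [Measure.real, h]
  have hFz : ∀ t : ℝ, t ≤ 0 → μ.real (Iio t) = 0 := by
    intro t ht
    have h : μ (Iio t) = 0 := measure_mono_null (by intro y; simp; intro; linarith) hnull
    simp [Measure.real, h]
  have hmono : Monotone (fun t => μ.real (Iio t)) :=
    fun a b hab => measureReal_mono (Iio_subset_Iio hab)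
  have hF : ∀ t : ℝ, (N : ℝ) * μ.real (Iio t)
      = ∑ i ∈ Finset.range N, μ.real (Iio ((t - i * R N ρ) / ρ)) := by
    intro t
    rw [cdf_eq N hN ρ hρ0 μ hprob hss _ measurableSet_Iio]
    simp only [preimage_Iio N ρ hρ0]
  have hball : ∀ x r : ℝ, x ≤ r → (μ (Ioo (x - r) (x + r))).toReal = μ.real (Iio (x + r)) := by
    intro x r hxr
    refine congrArg ENNReal.toReal (le_antisymm (measure_mono fun y hy => hy.2) ?_)
    calc μ (Iio (x + r)) ≤ μ (Ioo (x - r) (x + r) ∪ Iic 0) := by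
          refine measure_mono fun y hy => ?_
          rcases le_or_gt y 0 with h | h
          · exact Or.inr h
          · exact Or.inl ⟨by linarith, hy⟩
      _ ≤ _ := measure_union_le _ _
      _ = _ := by rw [hnull, add_zero]
  have hQ3 : 3 * ρ ≤ R N ρ := by nlinarith
  have hcore := core N hN ρ (R N ρ) hρ0 hR1 hR2 hR3 (fun t => μ.real (Iio t))
    (fun t => measureReal_nonneg) hF1 hmono hF
  have hFR : (N : ℝ) * μ.real (Iio (R N ρ)) = 1 := by
    rw [hF, Finset.sum_eq_single 0]
    · apply hF1
      rw [le_div_iff₀ hρ0]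
      push_cast
      linarith
    · intro i _ hi
      apply hFz
      have : (1 : ℝ) ≤ i := by exact_mod_cast Nat.one_le_iff_ne_zero.2 hi
      apply div_nonpos_of_nonpos_of_nonneg _ hρ0.le
      nlinarith
    · intro h
      exact absurd (Finset.mem_range.2 (by omega)) h
  have hFρ : ∀ t, ρ ≤ t → 1 ≤ (N : ℝ) * μ.real (Iio t) := by
    intro t ht
    rw [hF]
    have := Finset.single_le_sum (f := fun i : ℕ => μ.real (Iio ((t - i * R N ρ) / ρ)))
      (fun i _ => measureReal_nonneg) (Finset.mem_range.2 (show 0 < N by omega))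
    refine le_trans (le_of_eq ?_) this
    refine (hF1 _ ?_).symm
    rw [le_div_iff₀ hρ0]
    push_cast
    linarith
  intro x hx
  obtain ⟨hx0, hxρ⟩ := hx
  have hRx : 0 < R N ρ - x := by linarith
  constructor
  · intro r hr hr1
    obtain ⟨hr2, hr3⟩ := max_le_iff.1 hr
    have hr0 : 0 < r := by linarith
    rw [hball x r hr2, hρs, Real.mul_rpow (by norm_num) hr0.le]
    have h2 : (0 : ℝ) < 2 ^ s := by positivity
    have hrs : 0 < r ^ s := by positivity
    have hRs : 0 < (R N ρ - x) ^ s := by positivity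
    have hone := hFρ (x + r) (by linarith)
    have key : r ^ s ≤ N * μ.real (Iio (x + r)) * (R N ρ - x) ^ s := by
      rcases le_total r (R N ρ - x) with h | h
      · calc r ^ s ≤ (R N ρ - x) ^ s := Real.rpow_le_rpow hr0.le h hs0.le
          _ ≤ _ := le_mul_of_one_le_left hRs.le hone
      · rw [← div_le_iff₀ hRs, ← Real.div_rpow hr0.le hRx.le]
        have hc := hcore (x + r) (by linarith) (by linarith)
        have hb1 : 1 ≤ r / (R N ρ - x) := by rw [le_div_iff₀ hRx]; linarith
        have hb : r / (R N ρ - x) ≤ (N * μ.real (Iio (x + r))) ^ 2 := by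
          rw [div_le_iff₀ hRx]
          nlinarith
        calc (r / (R N ρ - x)) ^ s ≤ (r / (R N ρ - x)) ^ (1 / 2 : ℝ) :=
              Real.rpow_le_rpow_of_exponent_le hb1 hs1
          _ = √(r / (R N ρ - x)) := by rw [Real.sqrt_eq_rpow]
          _ ≤ _ := Real.sqrt_le_iff.2 ⟨by linarith, hb⟩
    rw [div_le_div_iff₀ (by positivity) (by positivity), one_div, inv_mul_le_iff₀ hN0]
    nlinarith
  · rw [hball x _ (by linarith), Real.mul_rpow (by norm_num) hRx.le, hρs]
    congr 1
    rw [add_sub_cancel, eq_div_iff hN0.ne', mul_comm]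
    exact hFR

/-- Lemma 2.4: lower bounds for `μ(B(x,r))/(2r)^s` near the two extreme level-1 pieces. -/
theorem lower_bound_extreme_pieces (N : ℕ) (hN : 2 ≤ N) (ρ : ℝ) (hρ0 : 0 < ρ)
    (hρ1 : ρ ≤ 1 / (N : ℝ) ^ 2) (s : ℝ) (hs : s = -Real.log N / Real.log ρ)
    (μ : Measure ℝ) (hprob : IsProbabilityMeasure μ) (hss : IsSelfSimilar N ρ μ) :
    (∀ x ∈ Icc (0 : ℝ) ρ,
      (∀ r : ℝ, max x (ρ - x) ≤ r → r ≤ 1 - x →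
        ρ ^ s / ((2 : ℝ) ^ s * (R N ρ - x) ^ s) ≤
          (μ (Ioo (x - r) (x + r))).toReal / (2 * r) ^ s) ∧
      (μ (Ioo (x - (R N ρ - x)) (x + (R N ρ - x)))).toReal / (2 * (R N ρ - x)) ^ s =
        ρ ^ s / ((2 : ℝ) ^ s * (R N ρ - x) ^ s)) ∧
    (∀ x ∈ Icc (1 - ρ) (1 : ℝ),
      (∀ r : ℝ, max (1 - x) (ρ - (1 - x)) ≤ r → r ≤ x →
        ρ ^ s / ((2 : ℝ) ^ s * (R N ρ - (1 - x)) ^ s) ≤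
          (μ (Ioo (x - r) (x + r))).toReal / (2 * r) ^ s) ∧
      (μ (Ioo (x - (R N ρ - (1 - x))) (x + (R N ρ - (1 - x))))).toReal /
          (2 * (R N ρ - (1 - x))) ^ s =
        ρ ^ s / ((2 : ℝ) ^ s * (R N ρ - (1 - x)) ^ s)) := by
  refine ⟨left_part N hN ρ hρ0 hρ1 s hs μ hprob hss, ?_⟩
  intro x hx
  have hg : Measurable (fun x : ℝ => 1 - x) := by fun_prop
  have key := left_part N hN ρ hρ0 hρ1 s hs (μ.map (fun x => 1 - x))
    (Measure.isProbabilityMeasure_map hg.aemeasurable) (reflect N hN ρ hρ0 hρ1 μ hss)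
    (1 - x) ⟨by linarith [hx.2], by linarith [hx.1]⟩
  have hb : ∀ r : ℝ, (μ.map (fun x => 1 - x)) (Ioo (1 - x - r) (1 - x + r))
      = μ (Ioo (x - r) (x + r)) := by
    intro r
    rw [Measure.map_apply hg measurableSet_Ioo]
    congr 1
    ext y
    simp only [mem_preimage, mem_Ioo]
    constructor <;> rintro ⟨h1, h2⟩ <;> constructor <;> linarith
  simp only [hb] at key
  refine ⟨fun r h1 h2 => key.1 r h1 (by linarith), key.2⟩

end HomogeneousCantorDensity
end

section
/- (i) If x ∈ [kR, kR+ρ/2] for some k ∈ {1,…,N−2}, then for any r with kR+ρ−x ≤ r ≤ max{x, 1−x} one has μ(B(x,r))/(2r)^s ≥ ρ^s/(2^s (R−(kR+ρ−x))^s), with equality when r = R−(kR+ρ−x). (ii) If x ∈ [kR+ρ/2, kR+ρ] for some k ∈ {1,…,N−2}, then for any r with x−kR ≤ r ≤ max{x, 1−x} one has μ(B(x,r))/(2r)^s ≥ ρ^s/(2^s (R−(x−kR))^s), with equality when r = R−(x−kR). -/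
open MeasureTheory Filter Set Topology ENNReal

namespace HomogeneousCantorDensity

theorem f_measurable (N : ℕ) (ρ : ℝ) (i : ℕ) : Measurable (f N ρ i) := by
  unfold f; fun_prop

theorem ss_real {N : ℕ} (hN : 2 ≤ N) {ρ : ℝ} {μ : Measure ℝ} [IsProbabilityMeasure μ]
    (hss : IsSelfSimilar N ρ μ) {A : Set ℝ} (hA : MeasurableSet A) :
    (N : ℝ) * μ.real A = ∑ i ∈ Finset.range N, μ.real (f N ρ i ⁻¹' A) := by
  have h : μ A = ∑ i ∈ Finset.range N, (N : ℝ≥0∞)⁻¹ * μ (f N ρ i ⁻¹' A) := by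
    unfold IsSelfSimilar at hss
    conv_lhs => rw [hss]
    rw [Measure.finsetSum_apply]
    refine Finset.sum_congr rfl fun i _ => ?_
    rw [Measure.smul_apply, Measure.map_apply (f_measurable N ρ i) hA, smul_eq_mul]
  have hN0 : (N : ℝ) ≠ 0 := by positivity
  unfold Measure.real
  rw [h, ENNReal.toReal_sum, Finset.mul_sum]
  · refine Finset.sum_congr rfl fun i _ => ?_
    rw [ENNReal.toReal_mul, ENNReal.toReal_inv, ENNReal.toReal_natCast]
    field_simp
  · intro i _
    refine ENNReal.mul_ne_top ?_ (measure_ne_top _ _)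
    simp; omega

theorem reflect_ss {N : ℕ} (hN : 2 ≤ N) {ρ : ℝ} {μ : Measure ℝ} [IsProbabilityMeasure μ]
    (hss : IsSelfSimilar N ρ μ) : IsSelfSimilar N ρ (μ.map (fun x => 1 - x)) := by
  have hg : Measurable (fun x : ℝ => 1 - x) := by fun_prop
  have hNR : ((N : ℝ) - 1) * R N ρ = 1 - ρ := by
    have : (2 : ℝ) ≤ N := by exact_mod_cast hN
    unfold R
    rw [mul_div_cancel₀]
    linarith
  unfold IsSelfSimilar at *
  ext A hA
  rw [Measure.map_apply hg hA]
  conv_lhs => rw [hss]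
  rw [Measure.finsetSum_apply, Measure.finsetSum_apply]
  rw [← Finset.sum_range_reflect]
  refine Finset.sum_congr rfl fun i hi => ?_
  have hi := Finset.mem_range.1 hi
  rw [Measure.smul_apply, Measure.smul_apply, Measure.map_apply (f_measurable _ _ _) (hg hA),
    Measure.map_apply (f_measurable _ _ _) hA, Measure.map_apply hg (f_measurable _ _ _ hA)]
  congr 2
  ext y
  simp only [mem_preimage]
  have : 1 - f N ρ (N - 1 - i) y = f N ρ i (1 - y) := by
    unfold f
    have : ((N - 1 - i : ℕ) : ℝ) = N - 1 - i := by
      rw [Nat.cast_sub (by omega), Nat.cast_sub (by omega)]; simp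
    rw [this]
    linear_combination -hNR
  rw [this]

theorem R_facts {N : ℕ} (hN : 2 ≤ N) {ρ : ℝ} (hρ0 : 0 < ρ) (hρ1 : ρ ≤ 1 / (N : ℝ) ^ 2) :
    ((N : ℝ) - 1) * R N ρ = 1 - ρ ∧ ((N : ℝ) + 1) * ρ ≤ R N ρ ∧ ρ < 1 ∧ (N : ℝ) * ρ ≤ 1 := by
  have h2 : (2 : ℝ) ≤ N := by exact_mod_cast hN
  have h3 : ρ * (N : ℝ) ^ 2 ≤ 1 := by rwa [le_div_iff₀ (by positivity)] at hρ1
  refine ⟨?_, ?_, ?_, ?_⟩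
  · unfold R
    rw [mul_div_cancel₀]
    linarith
  · unfold R
    rw [le_div_iff₀ (by linarith)]
    nlinarith
  · nlinarith
  · nlinarith

theorem Iic_zero {N : ℕ} (hN : 2 ≤ N) {ρ : ℝ} (hρ0 : 0 < ρ) (hρ1 : ρ ≤ 1 / (N : ℝ) ^ 2)
    {μ : Measure ℝ} [IsProbabilityMeasure μ] (hss : IsSelfSimilar N ρ μ) :
    μ.real (Iic 0) = 0 := by
  obtain ⟨hNR, hR, hρ, hNρ⟩ := R_facts hN hρ0 hρ1
  have h2 : (2 : ℝ) ≤ N := by exact_mod_cast hN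
  have hRpos : 0 < R N ρ := by nlinarith
  have step : ∀ c : ℝ, 0 < c → μ.real (Iio (-c)) ≤ μ.real (Iio (-(c / ρ))) := by
    intro c hc
    have := ss_real hN hss (measurableSet_Iio (a := -c))
    have h : ∑ i ∈ Finset.range N, μ.real (f N ρ i ⁻¹' Iio (-c)) ≤
        ∑ i ∈ Finset.range N, μ.real (Iio (-(c / ρ))) := by
      refine Finset.sum_le_sum fun i _ => measureReal_mono ?_
      intro y hy
      simp only [mem_preimage, mem_Iio, f] at *
      have : 0 ≤ (i : ℝ) * R N ρ := by positivity
      rw [← neg_div, lt_div_iff₀ hρ0]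
      linarith
    rw [← this] at h
    simp only [Finset.sum_const, Finset.card_range, nsmul_eq_mul] at h
    exact le_of_mul_le_mul_left h (by linarith)
  have stepn : ∀ (c : ℝ), 0 < c → ∀ n : ℕ, μ.real (Iio (-c)) ≤ μ.real (Iio (-(c / ρ ^ n))) := by
    intro c hc n
    induction n with
    | zero => simp
    | succ n ih =>
      refine ih.trans ((step _ (by positivity)).trans (le_of_eq ?_))
      rw [div_div, pow_succ]
  have hIio : ∀ c : ℝ, 0 < c → μ.real (Iio (-c)) = 0 := by
    intro c hc
    have ht : Tendsto (fun n : ℕ => -(c / ρ ^ n)) atTop atBot := by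
      refine tendsto_neg_atTop_atBot.comp ?_
      have := (tendsto_pow_atTop_atTop_of_one_lt (r := ρ⁻¹) ((one_lt_inv₀ hρ0).2 hρ)).const_mul_atTop hc
      refine this.congr fun n => ?_
      rw [inv_pow, div_eq_mul_inv]
    have hanti : Antitone (fun n : ℕ => Iio (-(c / ρ ^ n))) := by
      intro m n hmn
      refine Iio_subset_Iio ?_
      simp only [neg_le_neg_iff]
      exact div_le_div_of_nonneg_left hc.le (by positivity)
        (pow_le_pow_of_le_one hρ0.le hρ.le hmn)
    have hl := tendsto_measure_iInter_atTop (μ := μ) (s := fun n : ℕ => Iio (-(c / ρ ^ n)))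
      (fun n => measurableSet_Iio.nullMeasurableSet) hanti ⟨0, measure_ne_top _ _⟩
    have hempty : (⋂ n : ℕ, Iio (-(c / ρ ^ n))) = ∅ := by
      rw [eq_empty_iff_forall_notMem]
      intro y hy
      obtain ⟨n, hn⟩ := (ht.eventually (eventually_le_atBot y)).exists
      have := mem_iInter.1 hy n
      simp only [mem_Iio] at this
      linarith
    rw [hempty, measure_empty] at hl
    have hl2 := (ENNReal.tendsto_toReal (by simp)).comp hl
    have := ge_of_tendsto' hl2 (b := μ.real (Iio (-c))) (fun n => stepn c hc n)
    simp only [ENNReal.toReal_zero] at this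
    exact le_antisymm this measureReal_nonneg
  have hI0 : μ (Iio 0) = 0 := by
    have : (Iio (0 : ℝ)) ⊆ ⋃ n : ℕ, Iio (-(1 / ((n : ℝ) + 1))) := by
      intro y hy
      obtain ⟨n, hn⟩ := exists_nat_one_div_lt (show (0:ℝ) < -y from neg_pos.2 hy)
      refine mem_iUnion.2 ⟨n, ?_⟩
      simp only [mem_Iio]; linarith
    refine measure_mono_null this (measure_iUnion_null fun n => ?_)
    have := hIio (1 / ((n : ℝ) + 1)) (by positivity)
    exact (measureReal_eq_zero_iff).1 this
  have hI0' : μ.real (Iio 0) = 0 := (measureReal_eq_zero_iff).2 hI0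
  have hs0 : (N : ℝ) * μ.real {0} ≤ μ.real {0} := by
    rw [ss_real hN hss (measurableSet_singleton 0)]
    rw [Finset.sum_eq_single 0]
    · refine measureReal_mono ?_
      intro y hy
      simp only [mem_preimage, f, mem_singleton_iff] at *
      simp at hy
      rcases hy with h | h
      · linarith
      · exact h
    · intro i _ hi
      refine le_antisymm (le_trans (measureReal_mono (s₂ := Iio 0) ?_) hI0'.le) measureReal_nonneg
      intro y hy
      simp only [mem_preimage, f, mem_singleton_iff, mem_Iio] at *
      have : (1 : ℝ) ≤ i := by exact_mod_cast Nat.one_le_iff_ne_zero.2 hi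
      nlinarith
    · intro h; simp at h; omega
  have hs1 : μ.real {0} = 0 := by
    have : 0 ≤ μ.real {(0 : ℝ)} := measureReal_nonneg
    nlinarith
  rw [← Iio_union_right]
  refine le_antisymm ((measureReal_union_le _ _).trans ?_) measureReal_nonneg
  linarith

theorem Ioo_one {N : ℕ} (hN : 2 ≤ N) {ρ : ℝ} (hρ0 : 0 < ρ) (hρ1 : ρ ≤ 1 / (N : ℝ) ^ 2)
    {μ : Measure ℝ} [IsProbabilityMeasure μ] (hss : IsSelfSimilar N ρ μ) :
    μ.real (Ioo 0 1) = 1 := by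
  have hg : Measurable (fun x : ℝ => 1 - x) := by fun_prop
  have h0 := Iic_zero hN hρ0 hρ1 hss
  have : IsProbabilityMeasure (μ.map (fun x : ℝ => 1 - x)) :=
    Measure.isProbabilityMeasure_map hg.aemeasurable
  have h1 := Iic_zero hN hρ0 hρ1 (reflect_ss hN hss)
  rw [map_measureReal_apply hg measurableSet_Iic] at h1
  have hc : μ.real (Ioo (0 : ℝ) 1)ᶜ = 0 := by
    refine le_antisymm ?_ measureReal_nonneg
    refine (measureReal_mono (s₂ := Iic 0 ∪ (fun x : ℝ => 1 - x) ⁻¹' Iic 0) ?_).trans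
      ((measureReal_union_le _ _).trans (by linarith))
    intro y hy
    simp only [mem_compl_iff, mem_Ioo, mem_union, mem_Iic, mem_preimage] at *
    by_contra! h
    exact hy ⟨h.1, by linarith⟩
  have := probReal_add_probReal_compl (μ := μ) (measurableSet_Ioo (a := (0 : ℝ)) (b := 1))
  linarith

theorem sum_lower {N : ℕ} (hN : 2 ≤ N) {ρ : ℝ} {μ : Measure ℝ} [IsProbabilityMeasure μ]
    (hss : IsSelfSimilar N ρ μ) {A : Set ℝ} (hA : MeasurableSet A) {J : Finset ℕ}
    (hJ : ∀ i ∈ J, i < N) :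
    ∑ i ∈ J, μ.real (f N ρ i ⁻¹' A) ≤ (N : ℝ) * μ.real A := by
  rw [ss_real hN hss hA]
  exact Finset.sum_le_sum_of_subset_of_nonneg (fun i hi => Finset.mem_range.2 (hJ i hi))
    (fun _ _ _ => measureReal_nonneg)

theorem one_le_of_piece {N : ℕ} (hN : 2 ≤ N) {ρ : ℝ} (hρ0 : 0 < ρ) (hρ1 : ρ ≤ 1 / (N : ℝ) ^ 2)
    {μ : Measure ℝ} [IsProbabilityMeasure μ] (hss : IsSelfSimilar N ρ μ) {i : ℕ} {p q : ℝ}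
    (hp : p ≤ (i : ℝ) * R N ρ) (hq : (i : ℝ) * R N ρ + ρ ≤ q) :
    1 ≤ μ.real (f N ρ i ⁻¹' Ioo p q) := by
  rw [← Ioo_one hN hρ0 hρ1 hss]
  refine measureReal_mono ?_
  intro y hy
  simp only [mem_preimage, mem_Ioo, f] at *
  constructor <;> nlinarith

theorem count_lower {N : ℕ} (hN : 2 ≤ N) {ρ : ℝ} (hρ0 : 0 < ρ) (hρ1 : ρ ≤ 1 / (N : ℝ) ^ 2)
    {μ : Measure ℝ} [IsProbabilityMeasure μ] (hss : IsSelfSimilar N ρ μ) {p q : ℝ} {m n : ℕ}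
    (hmn : m ≤ n) (hn : n < N)
    (hp : p ≤ (m : ℝ) * R N ρ) (hq : (n : ℝ) * R N ρ + ρ ≤ q) :
    (n : ℝ) - m + 1 ≤ (N : ℝ) * μ.real (Ioo p q) := by
  obtain ⟨hNR, hR, hρ, hNρ⟩ := R_facts hN hρ0 hρ1
  have hRpos : 0 < R N ρ := by
    have : (0 : ℝ) ≤ N := by positivity
    nlinarith
  refine le_trans ?_ (sum_lower hN hss measurableSet_Ioo (J := Finset.Icc m n) ?_)
  · have : ∑ i ∈ Finset.Icc m n, (1 : ℝ) ≤ ∑ i ∈ Finset.Icc m n, μ.real (f N ρ i ⁻¹' Ioo p q) := by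
      refine Finset.sum_le_sum fun i hi => ?_
      rw [Finset.mem_Icc] at hi
      have h1 : (m : ℝ) ≤ i := by exact_mod_cast hi.1
      have h2 : (i : ℝ) ≤ n := by exact_mod_cast hi.2
      refine one_le_of_piece hN hρ0 hρ1 hss ?_ ?_ <;> nlinarith
    refine le_trans (le_of_eq ?_) this
    rw [Finset.sum_const, Nat.card_Icc, nsmul_eq_mul, Nat.cast_sub (by omega)]
    push_cast; ring
  · intro i hi
    rw [Finset.mem_Icc] at hi; omega

theorem tail_lower {N : ℕ} (hN : 2 ≤ N) {ρ : ℝ} (hρ0 : 0 < ρ) (hρ1 : ρ ≤ 1 / (N : ℝ) ^ 2)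
    {μ : Measure ℝ} [IsProbabilityMeasure μ] (hss : IsSelfSimilar N ρ μ) {u : ℝ}
    (hu0 : 0 < u) (hu1 : u ≤ 1) : u / N ≤ μ.real (Ioo (1 - u) 1) := by
  obtain ⟨hNR, hR, hρ, hNρ⟩ := R_facts hN hρ0 hρ1
  have h2 : (2 : ℝ) ≤ N := by exact_mod_cast hN
  have hcast : ((N - 1 : ℕ) : ℝ) = N - 1 := by rw [Nat.cast_sub (by omega)]; simp
  have key : ∀ n : ℕ, ∀ u : ℝ, ρ ^ n ≤ u → u ≤ 1 → u / N ≤ μ.real (Ioo (1 - u) 1) := by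
    intro n
    induction n with
    | zero =>
      intro u h1 h2'
      have : u = 1 := by simp at h1; linarith
      subst this
      rw [sub_self, Ioo_one hN hρ0 hρ1 hss, div_le_one (by linarith)]; linarith
    | succ n ih =>
      intro u h1 h2'
      rw [div_le_iff₀ (by linarith), mul_comm]
      by_cases hu : ρ ≤ u
      · have := count_lower hN hρ0 hρ1 hss (p := 1 - u) (q := 1) (m := N - 1) (n := N - 1) le_rfl
          (by omega) (by rw [hcast]; linarith) (by rw [hcast]; linarith)
        linarith
      · push Not at hu
        have h3 := ih (u / ρ) (by rw [le_div_iff₀ hρ0, ← pow_succ]; exact h1)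
          ((div_le_one hρ0).2 hu.le)
        have h4 := sum_lower hN hss (measurableSet_Ioo (a := 1 - u) (b := 1)) (J := {N - 1})
          (by simp; omega)
        rw [Finset.sum_singleton] at h4
        refine le_trans ?_ h4
        have h5 : μ.real (Ioo (1 - u / ρ) 1) ≤ μ.real (f N ρ (N - 1) ⁻¹' Ioo (1 - u) 1) := by
          refine measureReal_mono ?_
          intro y hy
          simp only [mem_preimage, mem_Ioo, f, hcast] at *
          have h6 : ρ * (1 - u / ρ) < ρ * y := mul_lt_mul_of_pos_left hy.1 hρ0
          have h7 : ρ * (1 - u / ρ) = ρ - u := by field_simp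
          constructor <;> nlinarith
        refine le_trans (le_trans ?_ h3) h5
        rw [div_div, le_div_iff₀ (by positivity)]
        have : 0 < u := lt_of_lt_of_le (by positivity) h1
        nlinarith
  obtain ⟨n, hn⟩ := exists_pow_lt_of_lt_one hu0 hρ
  exact key n u hn.le hu1

theorem s_facts {N : ℕ} (hN : 2 ≤ N) {ρ : ℝ} (hρ0 : 0 < ρ) (hρ1 : ρ ≤ 1 / (N : ℝ) ^ 2) {s : ℝ}
    (hs : s = -Real.log N / Real.log ρ) : 0 < s ∧ s ≤ 1 / 2 ∧ ρ ^ s = 1 / N := by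
  have h2 : (2 : ℝ) ≤ N := by exact_mod_cast hN
  have hl : 0 < Real.log N := Real.log_pos (by linarith)
  have h1 : Real.log ρ ≤ -(2 * Real.log N) := by
    have := Real.log_le_log hρ0 hρ1
    rw [one_div, Real.log_inv, Real.log_pow] at this
    exact_mod_cast this
  have h3 : Real.log ρ < 0 := by linarith
  refine ⟨?_, ?_, ?_⟩
  · rw [hs]; exact div_pos_of_neg_of_neg (by linarith) h3
  · rw [hs, div_le_iff_of_neg h3]; linarith
  · rw [Real.rpow_def_of_pos hρ0, hs, mul_div_cancel₀ _ h3.ne, Real.exp_neg,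
      Real.exp_log (by linarith), one_div]

/-- `r ≤ m² r₀` with `s ≤ 1/2` gives `(r/r₀)^s ≤ m`. -/
theorem rpow_aux {s r r0 m : ℝ} (hs0 : 0 < s) (hs : s ≤ 1 / 2) (hr : 0 < r) (hr0 : 0 < r0)
    (hm : 1 ≤ m) (h : r ≤ m ^ 2 * r0) : (r / r0) ^ s ≤ m := by
  have h1 : r / r0 ≤ m ^ 2 := by rwa [div_le_iff₀ hr0]
  calc (r / r0) ^ s ≤ (m ^ 2) ^ s := Real.rpow_le_rpow (by positivity) h1 hs0.le
    _ ≤ (m ^ 2) ^ (1 / 2 : ℝ) := Real.rpow_le_rpow_of_exponent_le (by nlinarith) hs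
    _ = m := by rw [← Real.sqrt_eq_rpow, Real.sqrt_sq (by linarith)]

set_option maxHeartbeats 2000000 in
theorem part_one (N : ℕ) (hN : 2 ≤ N) (ρ : ℝ) (hρ0 : 0 < ρ)
    (hρ1 : ρ ≤ 1 / (N : ℝ) ^ 2) (s : ℝ) (hs : s = -Real.log N / Real.log ρ)
    (μ : Measure ℝ) [IsProbabilityMeasure μ] (hss : IsSelfSimilar N ρ μ)
    (k : ℕ) (hk1 : 1 ≤ k) (hk2 : k ≤ N - 2) (x a : ℝ)
    (hx : x = (k : ℝ) * R N ρ + ρ - a) (ha1 : ρ / 2 ≤ a) (ha2 : a ≤ ρ) :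
      (∀ r : ℝ, a ≤ r → r ≤ max x (1 - x) →
        ρ ^ s / ((2 : ℝ) ^ s * (R N ρ - a) ^ s) ≤
          (μ (Ioo (x - r) (x + r))).toReal / (2 * r) ^ s) ∧
      (μ (Ioo (x - (R N ρ - a)) (x + (R N ρ - a)))).toReal / (2 * (R N ρ - a)) ^ s =
        ρ ^ s / ((2 : ℝ) ^ s * (R N ρ - a) ^ s) := by
  obtain ⟨hNR, hR, hρ, hNρ⟩ := R_facts hN hρ0 hρ1
  obtain ⟨hs0, hs2, hρs⟩ := s_facts hN hρ0 hρ1 hs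
  have hN3 : 3 ≤ N := by omega
  have h3 : (3 : ℝ) ≤ N := by exact_mod_cast hN3
  have hR4 : 4 * ρ ≤ R N ρ := by nlinarith
  have hRN : (N : ℝ) * ρ ≤ R N ρ - a := by nlinarith
  have hkN : (k : ℝ) + 2 ≤ N := by exact_mod_cast (by omega : k + 2 ≤ N)
  have hkr1 : (1 : ℝ) ≤ k := by exact_mod_cast hk1
  have hkc : ((k - 1 : ℕ) : ℝ) = k - 1 := by rw [Nat.cast_sub hk1]; simp
  set Q := R N ρ with hQ
  have hQ0 : 0 < Q := by linarith
  have hr0 : 0 < Q - a := by linarith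
  constructor
  · intro r har hrmax
    have hr : 0 < r := by linarith
    suffices H : (r / (Q - a)) ^ s ≤ (N : ℝ) * μ.real (Ioo (x - r) (x + r)) by
      change _ ≤ μ.real (Ioo (x - r) (x + r)) / (2 * r) ^ s
      rw [hρs, Real.mul_rpow (by norm_num) hr.le]
      rw [Real.div_rpow hr.le hr0.le] at H
      have p1 : 0 < (2 : ℝ) ^ s := by positivity
      have p2 : 0 < r ^ s := by positivity
      have p3 : 0 < (Q - a) ^ s := by positivity
      rw [div_le_iff₀ p3] at H
      rw [div_div, div_le_div_iff₀ (by positivity) (by positivity)]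
      nlinarith
    by_cases c1 : r ≤ Q - a
    · have h1 := count_lower hN hρ0 hρ1 hss (p := x - r) (q := x + r) (m := k) (n := k) le_rfl
        (by omega) (by rw [← hQ]; linarith) (by rw [← hQ]; linarith)
      have h2 : (r / (Q - a)) ^ s ≤ 1 :=
        Real.rpow_le_one (by positivity) ((div_le_one hr0).2 c1) hs0.le
      linarith
    push Not at c1
    by_cases c2 : r < Q - a + ρ
    · set t := r - (Q - a) with ht
      have ht0 : 0 < t := by linarith
      have h1 := tail_lower hN hρ0 hρ1 hss (u := t / ρ) (by positivity)
        ((div_le_one hρ0).2 (by linarith))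
      have h2 := sum_lower hN hss (measurableSet_Ioo (a := x - r) (b := x + r)) (J := {k - 1, k})
        (by intro i hi; simp at hi; omega)
      rw [Finset.sum_pair (by omega)] at h2
      have h4 : 1 ≤ μ.real (f N ρ k ⁻¹' Ioo (x - r) (x + r)) :=
        one_le_of_piece hN hρ0 hρ1 hss (by rw [← hQ]; linarith) (by rw [← hQ]; linarith)
      have h5 : μ.real (Ioo (1 - t / ρ) 1) ≤ μ.real (f N ρ (k - 1) ⁻¹' Ioo (x - r) (x + r)) := by
        refine measureReal_mono ?_
        intro y hy
        simp only [mem_preimage, mem_Ioo, f, hkc] at *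
        have h6 : ρ * (1 - t / ρ) < ρ * y := mul_lt_mul_of_pos_left hy.1 hρ0
        have h7 : ρ * (1 - t / ρ) = ρ - t := by field_simp
        have h8 : ρ * y < ρ := by nlinarith
        rw [← hQ]
        constructor <;> nlinarith
      have h6 : r / (Q - a) = 1 + t / (Q - a) := by rw [ht]; field_simp; ring
      have h7 := rpow_one_add_le_one_add_mul_self (s := t / (Q - a)) (p := s)
        (by have : 0 < t / (Q - a) := by positivity
            linarith) hs0.le (by linarith)
      rw [h6]
      have h8 : s * (t / (Q - a)) ≤ t / ρ / N := by
        have e1 : t / (Q - a) ≤ t / ρ / N := by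
          rw [div_div]
          exact div_le_div_of_nonneg_left ht0.le (by positivity) (by linarith)
        have : 0 < t / (Q - a) := by positivity
        nlinarith
      linarith
    push Not at c2
    by_cases c3 : r < Q + a
    · have h1 := count_lower hN hρ0 hρ1 hss (p := x - r) (q := x + r) (m := k - 1) (n := k)
        (by omega) (by omega) (by rw [← hQ, hkc]; linarith) (by rw [← hQ]; linarith)
      rw [hkc] at h1
      have h2 := rpow_aux hs0 hs2 hr hr0 (m := 2) (by norm_num) (by linarith)
      linarith
    push Not at c3
    set j := ⌊(r - a) / Q⌋₊ with hj
    have hj1 : (j : ℝ) * Q ≤ r - a := by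
      rw [← le_div_iff₀ hQ0]
      exact Nat.floor_le (div_nonneg (by linarith) hQ0.le)
    have hj2 : r - a < ((j : ℝ) + 1) * Q := by
      rw [← div_lt_iff₀ hQ0]
      exact Nat.lt_floor_add_one _
    have hjpos : 1 ≤ j := by
      rw [hj, Nat.one_le_floor_iff, le_div_iff₀ hQ0]; linarith
    have hjr : (1 : ℝ) ≤ j := by exact_mod_cast hjpos
    have h2 : (r / (Q - a)) ^ s ≤ (j : ℝ) + 1 := by
      refine rpow_aux hs0 hs2 hr hr0 (by linarith) ?_
      have e1 : 3 / 4 * Q ≤ Q - a := by linarith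
      have e2 : ((j : ℝ) + 1) ^ 2 * (3 / 4 * Q) ≤ ((j : ℝ) + 1) ^ 2 * (Q - a) :=
        mul_le_mul_of_nonneg_left e1 (by positivity)
      have e3 : ((j : ℝ) + 1 + 1 / 4) * Q ≤ (((j : ℝ) + 1) ^ 2 * (3 / 4)) * Q :=
        mul_le_mul_of_nonneg_right (by nlinarith) hQ0.le
      linarith
    refine h2.trans ?_
    rcases le_max_iff.1 hrmax with hm | hm
    · have hjk : j ≤ k := by
        have : (j : ℝ) * Q ≤ k * Q := by linarith
        exact_mod_cast le_of_mul_le_mul_right this hQ0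
      have hc : ((k - j : ℕ) : ℝ) = k - j := Nat.cast_sub hjk
      have h1 := count_lower hN hρ0 hρ1 hss (p := x - r) (q := x + r) (m := k - j) (n := k)
        (by omega) (by omega) (by rw [← hQ, hc]; linarith) (by rw [← hQ]; linarith)
      rw [hc] at h1
      linarith
    · have hjk : k + j ≤ N - 1 := by
        have : ((j : ℝ) + k + 1) * Q ≤ N * Q := by linarith
        have : (j : ℝ) + k + 1 ≤ N := le_of_mul_le_mul_right this hQ0
        have : j + k + 1 ≤ N := by exact_mod_cast this
        omega
      have h1 := count_lower hN hρ0 hρ1 hss (p := x - r) (q := x + r) (m := k) (n := k + j)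
        (by omega) (by omega) (by rw [← hQ]; linarith) (by rw [← hQ]; push_cast; linarith)
      push_cast at h1
      linarith
  · have H : (N : ℝ) * μ.real (Ioo (x - (Q - a)) (x + (Q - a))) = 1 := by
      rw [ss_real hN hss measurableSet_Ioo, Finset.sum_eq_single k]
      · exact le_antisymm measureReal_le_one
          (one_le_of_piece hN hρ0 hρ1 hss (by rw [← hQ]; linarith) (by rw [← hQ]; linarith))
      · intro i _ hik
        have hd : f N ρ i ⁻¹' Ioo (x - (Q - a)) (x + (Q - a)) ⊆ (Ioo 0 1)ᶜ := by
          intro y hy hy2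
          simp only [mem_preimage, mem_Ioo, f] at hy hy2
          rw [← hQ] at hy
          rcases lt_or_gt_of_ne hik with h | h
          · have h' : (i : ℝ) + 1 ≤ k := by exact_mod_cast h
            have e1 : ((i : ℝ) + 1) * Q ≤ k * Q := mul_le_mul_of_nonneg_right h' hQ0.le
            have e2 : ρ * y < ρ := by nlinarith
            linarith
          · have h' : (k : ℝ) + 1 ≤ i := by exact_mod_cast h
            have e1 : ((k : ℝ) + 1) * Q ≤ i * Q := mul_le_mul_of_nonneg_right h' hQ0.le
            have e2 : 0 < ρ * y := mul_pos hρ0 hy2.1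
            linarith
        have h1 := probReal_add_probReal_compl (μ := μ) (measurableSet_Ioo (a := (0 : ℝ)) (b := 1))
        rw [Ioo_one hN hρ0 hρ1 hss] at h1
        exact le_antisymm ((measureReal_mono hd).trans (by linarith)) measureReal_nonneg
      · intro h; simp at h; omega
    change μ.real (Ioo (x - (Q - a)) (x + (Q - a))) / _ = _
    have H2 : μ.real (Ioo (x - (Q - a)) (x + (Q - a))) = 1 / N := by
      rw [_root_.eq_div_iff (by positivity), mul_comm]; exact H
    rw [H2, hρs, Real.mul_rpow (by norm_num) hr0.le]

/-- Proposition 2.5: lower bounds for `μ(B(x,r))/(2r)^s` on middle level-1 pieces. -/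
theorem lower_bound_middle_pieces (N : ℕ) (hN : 2 ≤ N) (ρ : ℝ) (hρ0 : 0 < ρ)
    (hρ1 : ρ ≤ 1 / (N : ℝ) ^ 2) (s : ℝ) (hs : s = -Real.log N / Real.log ρ)
    (μ : Measure ℝ) (hprob : IsProbabilityMeasure μ) (hss : IsSelfSimilar N ρ μ)
    (k : ℕ) (hk1 : 1 ≤ k) (hk2 : k ≤ N - 2) :
    (∀ x ∈ Icc ((k : ℝ) * R N ρ) ((k : ℝ) * R N ρ + ρ / 2),
      (∀ r : ℝ, (k : ℝ) * R N ρ + ρ - x ≤ r → r ≤ max x (1 - x) →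
        ρ ^ s / ((2 : ℝ) ^ s * (R N ρ - ((k : ℝ) * R N ρ + ρ - x)) ^ s) ≤
          (μ (Ioo (x - r) (x + r))).toReal / (2 * r) ^ s) ∧
      (μ (Ioo (x - (R N ρ - ((k : ℝ) * R N ρ + ρ - x)))
              (x + (R N ρ - ((k : ℝ) * R N ρ + ρ - x))))).toReal /
          (2 * (R N ρ - ((k : ℝ) * R N ρ + ρ - x))) ^ s =
        ρ ^ s / ((2 : ℝ) ^ s * (R N ρ - ((k : ℝ) * R N ρ + ρ - x)) ^ s)) ∧
    (∀ x ∈ Icc ((k : ℝ) * R N ρ + ρ / 2) ((k : ℝ) * R N ρ + ρ),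
      (∀ r : ℝ, x - (k : ℝ) * R N ρ ≤ r → r ≤ max x (1 - x) →
        ρ ^ s / ((2 : ℝ) ^ s * (R N ρ - (x - (k : ℝ) * R N ρ)) ^ s) ≤
          (μ (Ioo (x - r) (x + r))).toReal / (2 * r) ^ s) ∧
      (μ (Ioo (x - (R N ρ - (x - (k : ℝ) * R N ρ)))
              (x + (R N ρ - (x - (k : ℝ) * R N ρ))))).toReal /
          (2 * (R N ρ - (x - (k : ℝ) * R N ρ))) ^ s =
        ρ ^ s / ((2 : ℝ) ^ s * (R N ρ - (x - (k : ℝ) * R N ρ)) ^ s)) := by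
  obtain ⟨hNR, -, -, -⟩ := R_facts hN hρ0 hρ1
  constructor
  · intro x hx
    exact part_one N hN ρ hρ0 hρ1 s hs μ hss k hk1 hk2 x _ (by ring)
      (by linarith [hx.2]) (by linarith [hx.1])
  · intro x hx
    have hg : Measurable (fun x : ℝ => 1 - x) := by fun_prop
    have : IsProbabilityMeasure (μ.map (fun x : ℝ => 1 - x)) :=
      Measure.isProbabilityMeasure_map hg.aemeasurable
    have hc : ((N - 1 - k : ℕ) : ℝ) = N - 1 - k := by
      rw [Nat.cast_sub (by omega), Nat.cast_sub (by omega)]; simp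
    have h := part_one N hN ρ hρ0 hρ1 s hs (μ.map (fun x : ℝ => 1 - x)) (reflect_ss hN hss)
      (N - 1 - k) (by omega) (by omega) (1 - x) (x - (k : ℝ) * R N ρ)
      (by rw [hc]; linear_combination -hNR) (by linarith [hx.1]) (by linarith [hx.2])
    have hpre : ∀ r : ℝ, (μ.map (fun x : ℝ => 1 - x)) (Ioo (1 - x - r) (1 - x + r)) =
        μ (Ioo (x - r) (x + r)) := by
      intro r
      rw [Measure.map_apply hg measurableSet_Ioo]
      congr 1
      ext y
      simp only [mem_preimage, mem_Ioo]
      constructor <;> rintro ⟨h1, h2⟩ <;> constructor <;> linarith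
    simp only [hpre] at h
    refine ⟨fun r hr1 hr2 => h.1 r hr1 ?_, h.2⟩
    rw [max_comm]
    simpa using hr2


end HomogeneousCantorDensity
end
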